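/- Let σ ≥ 0. Let P^X ∈ ℝ^{n_x×n_x} and P^V ∈ ℝ^{N×N} be orthogonal projection matrices (symmetric and idempotent). Let u : ℝ → ℝ^{n_x×N} and B : ℝ → ℝ^{n_x} be differentiable and satisfy, for all t: P^X u(t) = u(t), u(t) P^V = u(t), u′(t) = − P^X D^x u(t) A P^V + P^X D^xx u(t) |A| P^V + σ·( P^X B(t) e₁ᵀ P^V − u(t) ), and B′(t) = σ·( u(t) e₁ − B(t) ), where e₁ ∈ ℝ^{N} is the first standard basis vector. Then the semi-discrete system is energy stable: the total energy E(t) := (1/2)‖u(t)‖_F² + (1/2)‖B(t)‖² satisfies E′(t) ≤ 0 for all t. -/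

import Mathlib

open Matrix Finset

/-- Periodic first-order central difference stencil matrix `D^x`. -/
noncomputable def Dx (nx : ℕ) [NeZero nx] (dx : ℝ) : Matrix (Fin nx) (Fin nx) ℝ :=
  Matrix.of fun p q =>
    if q = p + 1 then 1 / (2 * dx) else if q = p - 1 then -(1 / (2 * dx)) else 0

/-- Periodic second-order stabilization stencil matrix `D^xx`. -/
noncomputable def Dxx (nx : ℕ) [NeZero nx] (dx : ℝ) : Matrix (Fin nx) (Fin nx) ℝ :=
  Matrix.of fun p q =>
    if q = p then -(1 / dx) else if q = p + 1 ∨ q = p - 1 then 1 / (2 * dx) else 0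

/-- The first standard basis vector `e₁ ∈ ℝ^N` (zeroth angular moment). -/
def e1 (N : ℕ) [NeZero N] : Fin N → ℝ := fun m => if m = 0 then 1 else 0

theorem aux_ne (nx : ℕ) [NeZero nx] (hnx : 3 ≤ nx) (p : Fin nx) :
    p + 1 ≠ p ∧ p - 1 ≠ p ∧ p + 1 ≠ p - 1 := by
  obtain ⟨m, rfl⟩ : ∃ m, nx = m + 3 := ⟨nx - 3, by omega⟩
  have h1 : (1 : Fin (m + 3)) ≠ 0 := by
    intro h
    have := congrArg Fin.val h
    simp at this
  have h2 : (1 + 1 : Fin (m + 3)) ≠ 0 := by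
    intro h
    have := congrArg Fin.val h
    simp [Fin.val_add] at this
    rw [Nat.mod_eq_of_lt (by omega)] at this
    omega
  refine ⟨by simpa using h1, by simpa using h1, ?_⟩
  intro h
  apply h2
  have h3 : p + (1 + 1) = p := by rw [← add_assoc, h, sub_add_cancel]
  simpa using h3

theorem aux_shift (nx : ℕ) [NeZero nx] (f : Fin nx → ℝ) :
    ∑ p, f (p + 1) = ∑ p, f p :=
  Equiv.sum_comp (Equiv.addRight (1 : Fin nx)) f

theorem aux_Dx (nx : ℕ) [NeZero nx] (hnx : 3 ≤ nx) (dx : ℝ) (v : Fin nx → ℝ) :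
    ∑ p, v p * ∑ q, Dx nx dx p q * v q = 0 := by
  have h : ∀ p, ∑ q, Dx nx dx p q * v q = 1 / (2 * dx) * (v (p + 1) - v (p - 1)) := by
    intro p
    obtain ⟨h1, h2, h3⟩ := aux_ne nx hnx p
    have : ∀ q, Dx nx dx p q * v q = (if q = p + 1 then 1 / (2 * dx) * v q else 0)
        + (if q = p - 1 then -(1 / (2 * dx)) * v q else 0) := by
      intro q
      simp only [Dx, Matrix.of_apply]
      by_cases a : q = p + 1
      · subst a; simp [h3]
      · simp [a]
    rw [Finset.sum_congr rfl (fun q _ => this q), Finset.sum_add_distrib]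
    simp only [Finset.sum_ite_eq', Finset.mem_univ, if_true]
    ring
  simp only [h]
  have e := aux_shift nx (fun p => v p * v (p - 1))
  simp only [add_sub_cancel_right] at e
  calc _ = 1 / (2 * dx) * (∑ p, v (p + 1) * v p - ∑ p, v p * v (p - 1)) := by
        rw [← Finset.sum_sub_distrib, Finset.mul_sum]
        exact Finset.sum_congr rfl fun p _ => by ring
    _ = 0 := by rw [e]; simp

theorem aux_Dxx (nx : ℕ) [NeZero nx] (hnx : 3 ≤ nx) (dx : ℝ) (hdx : 0 < dx) (v : Fin nx → ℝ) :
    ∑ p, v p * ∑ q, Dxx nx dx p q * v q ≤ 0 := by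
  have h : ∀ p, ∑ q, Dxx nx dx p q * v q
      = 1 / (2 * dx) * (v (p + 1) + v (p - 1) - 2 * v p) := by
    intro p
    obtain ⟨h1, h2, h3⟩ := aux_ne nx hnx p
    have : ∀ q, Dxx nx dx p q * v q = (if q = p + 1 then 1 / (2 * dx) * v q else 0)
        + (if q = p - 1 then (1 / (2 * dx)) * v q else 0)
        + (if q = p then -(1 / dx) * v q else 0) := by
      intro q
      simp only [Dxx, Matrix.of_apply]
      by_cases a : q = p + 1
      · subst a; rw [if_neg h1, if_pos (Or.inl rfl), if_pos rfl, if_neg h3, if_neg h1]; ring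
      · by_cases b : q = p - 1
        · subst b; rw [if_neg h2, if_pos (Or.inr rfl), if_neg a, if_pos rfl, if_neg h2]; ring
        · simp [a, b]
    rw [Finset.sum_congr rfl (fun q _ => this q), Finset.sum_add_distrib, Finset.sum_add_distrib]
    simp only [Finset.sum_ite_eq', Finset.mem_univ, if_true]
    field_simp
    ring
  simp only [h]
  have e := aux_shift nx (fun p => v p * v (p - 1))
  simp only [add_sub_cancel_right] at e
  have e2 := aux_shift nx (fun p => v p * v p)
  have : ∑ p, v p * (1 / (2 * dx) * (v (p + 1) + v (p - 1) - 2 * v p))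
      = -(1 / (2 * dx) * ∑ p, (v (p + 1) - v p) ^ 2) := by
    calc _ = 1 / (2 * dx) * (∑ p, v (p + 1) * v p + ∑ p, v p * v (p - 1)
              - ∑ p, v p * v p - ∑ p, v p * v p) := by
          rw [← Finset.sum_add_distrib, ← Finset.sum_sub_distrib, ← Finset.sum_sub_distrib,
            Finset.mul_sum]
          exact Finset.sum_congr rfl fun p _ => by ring
      _ = 1 / (2 * dx) * (∑ p, v (p + 1) * v p + ∑ p, v (p + 1) * v p
              - ∑ p, v (p + 1) * v (p + 1) - ∑ p, v p * v p) := by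
          rw [e, e2]
      _ = _ := by
          rw [← Finset.sum_add_distrib, ← Finset.sum_sub_distrib, ← Finset.sum_sub_distrib,
            ← mul_neg, ← Finset.sum_neg_distrib]
          congr 1
          exact Finset.sum_congr rfl fun p _ => by ring
  rw [this]
  have : 0 ≤ ∑ p, (v (p + 1) - v p) ^ 2 := Finset.sum_nonneg fun p _ => sq_nonneg _
  have : 0 ≤ 1 / (2 * dx) * ∑ p, (v (p + 1) - v p) ^ 2 := by positivity
  linarith

theorem aux_inner {m n : ℕ} (U M : Matrix (Fin m) (Fin n) ℝ) :
    ∑ j, ∑ k, U j k * M j k = (Uᵀ * M).trace := by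
  simp only [Matrix.trace, Matrix.diag, Matrix.mul_apply, Matrix.transpose_apply]
  exact Finset.sum_comm

theorem aux_proj {m n : ℕ} (U M : Matrix (Fin m) (Fin n) ℝ)
    (PX : Matrix (Fin m) (Fin m) ℝ) (hX : PXᵀ = PX)
    (PV : Matrix (Fin n) (Fin n) ℝ) (hV : PVᵀ = PV) (h1 : PX * U = U) (h2 : U * PV = U) :
    (Uᵀ * (PX * M * PV)).trace = (Uᵀ * M).trace := by
  have a : Uᵀ * PX = Uᵀ := by
    have := congrArg Matrix.transpose h1
    rwa [Matrix.transpose_mul, hX] at this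
  have b : PV * Uᵀ = Uᵀ := by
    have := congrArg Matrix.transpose h2
    rwa [Matrix.transpose_mul, hV] at this
  rw [← Matrix.mul_assoc, Matrix.trace_mul_comm, ← Matrix.mul_assoc, ← Matrix.mul_assoc, b, a]

theorem aux_diag {m n : ℕ} (U : Matrix (Fin m) (Fin n) ℝ) (D : Matrix (Fin m) (Fin m) ℝ)
    (Q : Matrix (Fin n) (Fin n) ℝ) (d : Fin n → ℝ) :
    (Uᵀ * (D * U * (Q * Matrix.diagonal d * Qᵀ))).trace
      = ∑ i, d i * ∑ p, (U * Q) p i * ∑ q, D p q * (U * Q) q i := by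
  have : (Uᵀ * (D * U * (Q * Matrix.diagonal d * Qᵀ))).trace
      = ((U * Q)ᵀ * (D * (U * Q)) * Matrix.diagonal d).trace := by
    rw [Matrix.transpose_mul]
    have e : Uᵀ * (D * U * (Q * Matrix.diagonal d * Qᵀ))
      = (Uᵀ * (D * U * (Q * Matrix.diagonal d))) * Qᵀ := by simp only [Matrix.mul_assoc]
    rw [e, Matrix.trace_mul_comm]
    simp only [Matrix.mul_assoc]
  rw [this]
  simp only [Matrix.trace, Matrix.diag, Matrix.mul_diagonal]
  refine Finset.sum_congr rfl fun i _ => ?_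
  rw [mul_comm, Matrix.mul_apply]
  simp only [Matrix.transpose_apply, Matrix.mul_apply (M := D)]

/-- Theorem 1 of the paper (energy stability of the semi-discrete system): along solutions
of `u′ = −P^X D^x u A P^V + P^X D^xx u |A| P^V + σ(P^X B e₁ᵀ P^V − u)`,
`B′ = σ(u e₁ − B)`, the total energy `E = ½‖u‖_F² + ½‖B‖²` satisfies `E′(t) ≤ 0`. -/
theorem semidiscrete_energy_stability (nx N : ℕ) [NeZero nx] [NeZero N]
    (hnx : 3 ≤ nx) (dx : ℝ) (hdx : 0 < dx)
    (Q : Matrix (Fin N) (Fin N) ℝ) (hQ : Qᵀ * Q = 1) (hQ' : Q * Qᵀ = 1)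
    (σs : Fin N → ℝ) (σ : ℝ) (hσ : 0 ≤ σ)
    (PX : Matrix (Fin nx) (Fin nx) ℝ) (hPXsymm : PXᵀ = PX) (hPXidem : PX * PX = PX)
    (PV : Matrix (Fin N) (Fin N) ℝ) (hPVsymm : PVᵀ = PV) (hPVidem : PV * PV = PV)
    (u : ℝ → Matrix (Fin nx) (Fin N) ℝ) (B : ℝ → Fin nx → ℝ)
    (hproju1 : ∀ t, PX * u t = u t) (hproju2 : ∀ t, u t * PV = u t)
    (hu : ∀ t j k, HasDerivAt (fun s => u s j k)
      ((-(PX * Dx nx dx * u t * (Q * Matrix.diagonal σs * Qᵀ) * PV)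
        + PX * Dxx nx dx * u t * (Q * Matrix.diagonal (fun i => |σs i|) * Qᵀ) * PV
        + σ • (PX * Matrix.vecMulVec (B t) (e1 N) * PV - u t)) j k) t)
    (hB : ∀ t j, HasDerivAt (fun s => B s j)
      (σ * ((u t).mulVec (e1 N) j - B t j)) t) :
    ∀ t, deriv
      (fun s => (1 / 2) * ∑ j, ∑ m, (u s j m) ^ 2 + (1 / 2) * ∑ j, (B s j) ^ 2) t ≤ 0 := by
  intro t
  have hd : HasDerivAt
      (fun s => (1 / 2) * ∑ j, ∑ m, (u s j m) ^ 2 + (1 / 2) * ∑ j, (B s j) ^ 2) _ t :=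
    ((HasDerivAt.fun_sum fun j _ => HasDerivAt.fun_sum fun m _ => (hu t j m).pow 2).const_mul
      (1 / 2 : ℝ)).add
    ((HasDerivAt.fun_sum fun j _ => (hB t j).pow 2).const_mul (1 / 2 : ℝ))
  rw [hd.deriv]
  clear hd hu hB
  have h1 := hproju1 t
  have h2 := hproju2 t
  generalize u t = U at *
  generalize B t = b at *
  set X1 := PX * Dx nx dx * U * (Q * Matrix.diagonal σs * Qᵀ) * PV with hX1
  set X2 := PX * Dxx nx dx * U * (Q * Matrix.diagonal (fun i => |σs i|) * Qᵀ) * PV with hX2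
  set X3 := PX * Matrix.vecMulVec b (e1 N) * PV with hX3
  have t1 : ∑ j, ∑ k, U j k * X1 j k = 0 := by
    have : X1 = PX * (Dx nx dx * U * (Q * Matrix.diagonal σs * Qᵀ)) * PV := by
      rw [hX1]; simp only [Matrix.mul_assoc]
    rw [aux_inner, this, aux_proj U _ PX hPXsymm PV hPVsymm h1 h2, aux_diag]
    refine Finset.sum_eq_zero fun i _ => ?_
    rw [aux_Dx nx hnx dx (fun p => (U * Q) p i), mul_zero]
  have t2 : ∑ j, ∑ k, U j k * X2 j k ≤ 0 := by
    have : X2 = PX * (Dxx nx dx * U * (Q * Matrix.diagonal (fun i => |σs i|) * Qᵀ)) * PV := by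
      rw [hX2]; simp only [Matrix.mul_assoc]
    rw [aux_inner, this, aux_proj U _ PX hPXsymm PV hPVsymm h1 h2, aux_diag]
    refine Finset.sum_nonpos fun i _ => ?_
    exact mul_nonpos_of_nonneg_of_nonpos (abs_nonneg _)
      (aux_Dxx nx hnx dx hdx (fun p => (U * Q) p i))
  have t3 : ∑ j, ∑ k, U j k * X3 j k = ∑ j, U j 0 * b j := by
    rw [aux_inner, hX3, aux_proj U _ PX hPXsymm PV hPVsymm h1 h2, ← aux_inner]
    refine Finset.sum_congr rfl fun j _ => ?_
    simp [Matrix.vecMulVec_apply, e1]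
  have t4 : ∀ j, (U.mulVec (e1 N)) j = U j 0 := by
    intro j
    simp [Matrix.mulVec, dotProduct, e1]
  have t5 : ∑ j, U j 0 ^ 2 ≤ ∑ j, ∑ k, U j k ^ 2 :=
    Finset.sum_le_sum fun j _ =>
      Finset.single_le_sum (f := fun k => U j k ^ 2) (fun k _ => sq_nonneg _) (Finset.mem_univ 0)
  have t6 : 0 ≤ ∑ j, U j 0 ^ 2 - 2 * ∑ j, U j 0 * b j + ∑ j, b j ^ 2 := by
    rw [Finset.mul_sum, ← Finset.sum_sub_distrib, ← Finset.sum_add_distrib]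
    exact Finset.sum_nonneg fun j _ => by nlinarith [sq_nonneg (U j 0 - b j)]
  have t7 := mul_nonneg hσ
    (show 0 ≤ ∑ j, ∑ k, U j k ^ 2 - 2 * ∑ j, U j 0 * b j + ∑ j, b j ^ 2 by linarith)
  have key1 : (1 / 2 : ℝ) * ∑ j, ∑ m, (((2 : ℕ) : ℝ) * U j m ^ (2 - 1)
      * (-X1 + X2 + σ • (X3 - U)) j m)
      = -(∑ j, ∑ k, U j k * X1 j k) + ∑ j, ∑ k, U j k * X2 j k
        + σ * (∑ j, ∑ k, U j k * X3 j k - ∑ j, ∑ k, U j k ^ 2) := by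
    simp only [Finset.mul_sum, ← Finset.sum_neg_distrib, ← Finset.sum_sub_distrib,
      ← Finset.sum_add_distrib]
    refine Finset.sum_congr rfl fun j _ => Finset.sum_congr rfl fun k _ => ?_
    simp only [Matrix.add_apply, Matrix.neg_apply, Matrix.smul_apply, Matrix.sub_apply,
      smul_eq_mul]
    push_cast
    ring
  have key2 : (1 / 2 : ℝ) * ∑ j, (((2 : ℕ) : ℝ) * b j ^ (2 - 1)
      * (σ * ((U.mulVec (e1 N)) j - b j)))
      = σ * (∑ j, U j 0 * b j - ∑ j, b j ^ 2) := by
    simp only [Finset.mul_sum, ← Finset.sum_sub_distrib]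
    refine Finset.sum_congr rfl fun j _ => ?_
    rw [t4]
    push_cast
    ring
  rw [key1, key2, t1, t3]
  linarith
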